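/- arXiv:2208.10020 — 8 statements merged into one kernel-verified Lean document; each statement's English description precedes it below -/
import Mathlib

section
/- Let n ≥ 2 and 0 < δ < π/2. Assume κ₁ ≥ κ₂ ≥ … ≥ κₙ are real numbers satisfying ∑_{i=1}^n arctan κᵢ ≥ (n−2)π/2 + δ. Then (i) κ₁ ≥ κ₂ ≥ … ≥ κ_{n−1} > 0 and |κₙ| ≤ κ_{n−1}; and (ii) ∑_{i=1}^n κᵢ ≥ 0. -/
open Real

theorem pair_pos (n : ℕ) (hn : 2 ≤ n) (δ : ℝ) (hδ0 : 0 < δ)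
    (κ : Fin n → ℝ)
    (hF : ((n : ℝ) - 2) * π / 2 + δ ≤ ∑ i, Real.arctan (κ i))
    (i j : Fin n) (hij : i ≠ j) : 0 < κ i + κ j := by
  have hj : j ∈ Finset.univ.erase i := by simp [hij.symm]
  have h1 := Finset.add_sum_erase Finset.univ (fun k => arctan (κ k)) (Finset.mem_univ i)
  have h2 := Finset.add_sum_erase (Finset.univ.erase i) (fun k => arctan (κ k)) hj
  have h3 : ∑ k ∈ (Finset.univ.erase i).erase j, arctan (κ k)
      ≤ ((Finset.univ.erase i).erase j).card • (π / 2) :=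
    Finset.sum_le_card_nsmul _ _ _ (fun k _ => (arctan_lt_pi_div_two _).le)
  have hc : ((Finset.univ.erase i).erase j).card = n - 2 := by
    rw [Finset.card_erase_of_mem hj, Finset.card_erase_of_mem (Finset.mem_univ i)]
    simp; omega
  rw [hc, nsmul_eq_mul, Nat.cast_sub hn] at h3
  push_cast at h3
  have h4 : arctan (-κ j) < arctan (κ i) := by
    rw [arctan_neg]; linarith
  have := arctan_strictMono.lt_iff_lt.mp h4
  linarith

/-- Structure of decreasing tuples with `∑ᵢ arctan κᵢ ≥ (n−2)π/2 + δ`: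
all but possibly the last entry are positive, `|κₙ| ≤ κ_{n−1}`, and the sum of the
entries is nonnegative. -/
theorem statement3 (n : ℕ) (hn : 2 ≤ n) (δ : ℝ) (hδ0 : 0 < δ) (hδ1 : δ < π / 2)
    (κ : Fin n → ℝ) (hdec : ∀ i j : Fin n, i ≤ j → κ j ≤ κ i)
    (hF : ((n : ℝ) - 2) * π / 2 + δ ≤ ∑ i, Real.arctan (κ i)) :
    (∀ i : Fin n, (i : ℕ) < n - 1 → 0 < κ i) ∧
    |κ ⟨n - 1, by omega⟩| ≤ κ ⟨n - 2, by omega⟩ ∧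
    0 ≤ ∑ i, κ i := by
  have hp := pair_pos n hn δ hδ0 κ hF
  have hpos : ∀ i : Fin n, (i : ℕ) < n - 1 → 0 < κ i := by
    intro i hi
    have h1 := hp i ⟨n - 1, by omega⟩ (by intro h; rw [h] at hi; simp at hi)
    have h2 := hdec i ⟨n - 1, by omega⟩ (by rw [Fin.le_def]; simp; omega)
    linarith
  refine ⟨hpos, ?_, ?_⟩
  · have h1 := hp ⟨n - 2, by omega⟩ ⟨n - 1, by omega⟩ (by simp; omega)
    have h2 := hdec ⟨n - 2, by omega⟩ ⟨n - 1, by omega⟩ (by rw [Fin.le_def]; simp; omega)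
    rw [abs_le]
    constructor <;> linarith
  · obtain ⟨m, rfl⟩ : ∃ m, n = m + 2 := ⟨n - 2, by omega⟩
    rw [Fin.sum_univ_castSucc, Fin.sum_univ_castSucc]
    have h1 := hp (Fin.last m).castSucc (Fin.last (m + 1)) (by simp [Fin.ext_iff])
    have h2 : 0 ≤ ∑ i : Fin m, κ i.castSucc.castSucc :=
      Finset.sum_nonneg (fun i _ => (hpos _ (by have := i.isLt; simp only [Fin.val_castSucc]; omega)).le)
    linarith
end

section
/- Let n ≥ 2 and 0 < δ < π/2. Assume κ₁ ≥ κ₂ ≥ … ≥ κₙ are real numbers satisfying ∑_{i=1}^n arctan κᵢ ≥ (n−2)π/2 + δ. Then (iii) κₙ ≥ −1/tan(δ); and (iv) if κₙ < 0, then ∑_{i=1}^n 1/κᵢ ≤ −tan(δ). -/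
open Real

lemma tan_superadd (x y : ℝ) (hx : 0 ≤ x) (hy : 0 ≤ y) (h : x + y < π / 2) :
    tan x + tan y ≤ tan (x + y) := by
  have c1 : 0 < cos x := cos_pos_of_mem_Ioo ⟨by linarith, by linarith⟩
  have c2 : 0 < cos y := cos_pos_of_mem_Ioo ⟨by linarith, by linarith⟩
  have c3 : 0 < cos (x + y) := cos_pos_of_mem_Ioo ⟨by linarith, by linarith⟩
  have t1 : 0 ≤ tan x := tan_nonneg_of_nonneg_of_le_pi_div_two hx (by linarith)
  have t2 : 0 ≤ tan y := tan_nonneg_of_nonneg_of_le_pi_div_two hy (by linarith)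
  have t3 : 0 ≤ tan (x + y) := tan_nonneg_of_nonneg_of_le_pi_div_two (by linarith) (by linarith)
  have e : tan (x + y) * (1 - tan x * tan y) = tan x + tan y := by
    have e1 : 1 - tan x * tan y = cos (x + y) / (cos x * cos y) := by
      rw [tan_eq_sin_div_cos, tan_eq_sin_div_cos, cos_add]
      field_simp
    have e2 : tan x + tan y = sin (x + y) / (cos x * cos y) := by
      rw [tan_eq_sin_div_cos, tan_eq_sin_div_cos, sin_add]
      field_simp
    rw [e1, e2, tan_eq_sin_div_cos]
    field_simp
  nlinarith [mul_nonneg t3 (mul_nonneg t1 t2)]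

lemma tan_superadd_sum {ι : Type*} (s : Finset ι) (d : ℝ) (hd : 0 ≤ d) (θ : ι → ℝ)
    (hθ : ∀ i, 0 ≤ θ i) (h : d + ∑ i ∈ s, θ i < π / 2) :
    tan d + ∑ i ∈ s, tan (θ i) ≤ tan (d + ∑ i ∈ s, θ i) := by
  classical
  induction s using Finset.induction_on with
  | empty => simp
  | insert a s ha ih =>
    rw [Finset.sum_insert ha] at h
    rw [Finset.sum_insert ha, Finset.sum_insert ha]
    have h0 := hθ a
    have h1 : 0 ≤ ∑ i ∈ s, θ i := Finset.sum_nonneg fun i _ => hθ i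
    have h2 := ih (by linarith)
    have h3 := tan_superadd (θ a) (d + ∑ i ∈ s, θ i) h0 (by linarith) (by linarith)
    rw [show d + (θ a + ∑ i ∈ s, θ i) = θ a + (d + ∑ i ∈ s, θ i) by ring]
    linarith

/-- For decreasing tuples with `∑ᵢ arctan κᵢ ≥ (n−2)π/2 + δ`: the smallest entry
satisfies `κₙ ≥ −1/tan δ`, and if `κₙ < 0` then `∑ᵢ 1/κᵢ ≤ −tan δ`. -/
theorem statement4 (n : ℕ) (hn : 2 ≤ n) (δ : ℝ) (hδ0 : 0 < δ) (hδ1 : δ < π / 2)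
    (κ : Fin n → ℝ) (hdec : ∀ i j : Fin n, i ≤ j → κ j ≤ κ i)
    (hF : ((n : ℝ) - 2) * π / 2 + δ ≤ ∑ i, Real.arctan (κ i)) :
    -(1 / Real.tan δ) ≤ κ ⟨n - 1, by omega⟩ ∧
    (κ ⟨n - 1, by omega⟩ < 0 → ∑ i, 1 / κ i ≤ -Real.tan δ) := by
  obtain ⟨m, rfl⟩ : ∃ m, n = m + 1 := ⟨n - 1, by omega⟩
  change -(1 / Real.tan δ) ≤ κ (Fin.last m) ∧
    (κ (Fin.last m) < 0 → ∑ i, 1 / κ i ≤ -Real.tan δ)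
  rw [Fin.sum_univ_castSucc] at hF ⊢
  set L := κ (Fin.last m) with hL
  set θ : Fin m → ℝ := fun i => π / 2 - arctan (κ i.castSucc) with hθdef
  have hθ : ∀ i, 0 ≤ θ i := fun i => by
    have := arctan_lt_pi_div_two (κ i.castSucc)
    simp only [hθdef]; linarith
  have hsum : ∑ i, θ i = m * (π / 2) - ∑ i : Fin m, arctan (κ i.castSucc) := by
    simp [hθdef, Finset.sum_sub_distrib]
  have hS : 0 ≤ ∑ i, θ i := Finset.sum_nonneg fun i _ => hθ i
  push_cast at hF
  have hkey : δ + ∑ i, θ i ≤ π / 2 + arctan L := by rw [hsum]; linarith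
  have htan : ∀ i, tan (θ i) = 1 / κ i.castSucc := fun i => by
    simp only [hθdef]; rw [tan_pi_div_two_sub, tan_arctan, one_div]
  have hlo := neg_pi_div_two_lt_arctan L
  have hhi := arctan_lt_pi_div_two L
  constructor
  · have h1 : δ - π / 2 ≤ arctan L := by linarith
    have h2 : arctan (-(1 / tan δ)) = δ - π / 2 := by
      rw [arctan_neg, one_div, ← tan_pi_div_two_sub, arctan_tan (by linarith) (by linarith)]
      ring
    rw [← h2] at h1
    exact arctan_le_arctan_iff.mp h1
  · intro hneg
    have ha : arctan L < 0 := by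
      rw [← arctan_zero]; exact arctan_lt_arctan_iff.mpr hneg
    have h1 := tan_superadd_sum Finset.univ δ hδ0.le θ hθ (by linarith)
    have h2 : tan (δ + ∑ i, θ i) ≤ tan (π / 2 + arctan L) :=
      strictMonoOn_tan.monotoneOn ⟨by linarith, by linarith⟩ ⟨by linarith, by linarith⟩ hkey
    have h3 : tan (π / 2 + arctan L) = - (1 / L) := by
      rw [show π / 2 + arctan L = π / 2 - arctan (-L) by rw [arctan_neg]; ring,
        tan_pi_div_two_sub, tan_arctan, one_div, inv_neg]
    simp only [htan] at h1
    linarith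
end

section
/- Let n ≥ 2 and let σ ∈ ((n−2)π/2, nπ/2). Then the set Γ^σ = {κ ∈ ℝⁿ : ∑_{i=1}^n arctan κᵢ > σ} is a convex subset of ℝⁿ. -/
open Real

/-- Addition formula for the arc cotangent. -/
lemma arccot_add_aux {u v : ℝ} (h : 0 < u + v) :
    arctan u + arctan v = π / 2 + arctan ((u * v - 1) / (u + v)) := by
  have h1 : arctan (-v) < arctan u := arctan_strictMono (by linarith)
  rw [arctan_neg] at h1
  have h2 := arctan_lt_pi_div_two u
  have h3 := arctan_lt_pi_div_two v
  have key : tan (arctan u + arctan v - π / 2) = (u * v - 1) / (u + v) := by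
    have cu := cos_arctan_pos u
    have cv := cos_arctan_pos v
    have su : sin (arctan u) = u * cos (arctan u) := by
      have := tan_arctan u
      rw [tan_eq_sin_div_cos, div_eq_iff cu.ne'] at this
      exact this
    have sv : sin (arctan v) = v * cos (arctan v) := by
      have := tan_arctan v
      rw [tan_eq_sin_div_cos, div_eq_iff cv.ne'] at this
      exact this
    rw [tan_eq_sin_div_cos, sin_sub_pi_div_two, cos_sub_pi_div_two, cos_add, sin_add, su, sv]
    generalize cos (arctan u) = c at *
    generalize cos (arctan v) = d at *
    have hs : u * c * d + c * (v * d) = (c * d) * (u + v) := by ring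
    have hc : -(c * d - u * c * (v * d)) = (c * d) * (u * v - 1) := by ring
    rw [hs, hc, mul_div_mul_left _ _ (mul_pos cu cv).ne']
  have := arctan_tan (x := arctan u + arctan v - π / 2) (by linarith) (by linarith)
  rw [key] at this
  linarith

lemma arccot_inv_aux {u v w : ℝ} (h : arctan u + arctan v = π / 2 + arctan w) :
    0 < u + v ∧ w * (u + v) = u * v - 1 := by
  have h1 : 0 < u + v := by
    have := neg_pi_div_two_lt_arctan w
    have h2 : arctan (-v) < arctan u := by rw [arctan_neg]; linarith
    have := arctan_strictMono.lt_iff_lt.1 h2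
    linarith
  refine ⟨h1, ?_⟩
  have h2 := arccot_add_aux h1
  have h3 : w = (u * v - 1) / (u + v) := arctan_injective (by linarith)
  rw [h3, div_mul_cancel₀ _ h1.ne']

lemma two_var_aux {a b u₁ v₁ w₁ u₂ v₂ w₂ : ℝ} (ha : 0 ≤ a) (hb : 0 ≤ b) (hab : a + b = 1)
    (h₁ : arctan u₁ + arctan v₁ = π / 2 + arctan w₁)
    (h₂ : arctan u₂ + arctan v₂ = π / 2 + arctan w₂) :
    π / 2 + arctan (a * w₁ + b * w₂) ≤ arctan (a * u₁ + b * u₂) + arctan (a * v₁ + b * v₂) := by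
  obtain ⟨p₁, e₁⟩ := arccot_inv_aux h₁
  obtain ⟨p₂, e₂⟩ := arccot_inv_aux h₂
  have hs : 0 < (a * u₁ + b * u₂) + (a * v₁ + b * v₂) := by
    have : (a * u₁ + b * u₂) + (a * v₁ + b * v₂) = a * (u₁ + v₁) + b * (u₂ + v₂) := by ring
    rw [this]
    rcases ha.eq_or_lt with h | h
    · have hb1 : b = 1 := by linarith
      rw [← h, hb1]; linarith
    · have := mul_pos h p₁
      have := mul_nonneg hb p₂.le
      linarith
  rw [arccot_add_aux hs]
  gcongr
  rw [le_div_iff₀ hs]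
  have cross : w₁ * (u₂ + v₂) + w₂ * (u₁ + v₁) ≤ u₁ * v₂ + u₂ * v₁ - 2 := by
    have hp := mul_pos p₁ p₂
    refine le_of_mul_le_mul_right ?_ hp
    have : (w₁ * (u₂ + v₂) + w₂ * (u₁ + v₁)) * ((u₁ + v₁) * (u₂ + v₂))
        = (u₁ * v₁ - 1) * (u₂ + v₂) ^ 2 + (u₂ * v₂ - 1) * (u₁ + v₁) ^ 2 := by
      rw [← e₁, ← e₂]; ring
    rw [this]
    nlinarith [sq_nonneg (u₁ + v₁ - (u₂ + v₂)), sq_nonneg (u₁ * v₂ - u₂ * v₁)]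
  have c2 := mul_le_mul_of_nonneg_left cross (mul_nonneg ha hb)
  have hb' : b = 1 - a := by linarith
  have e : (a * w₁ + b * w₂) * (a * u₁ + b * u₂ + (a * v₁ + b * v₂))
      = a ^ 2 * (w₁ * (u₁ + v₁)) + b ^ 2 * (w₂ * (u₂ + v₂))
        + a * b * (w₁ * (u₂ + v₂) + w₂ * (u₁ + v₁)) := by ring
  rw [e, e₁, e₂]
  have : (a + b) ^ 2 = 1 := by rw [hab]; norm_num
  nlinarith

lemma exists_arccot {t : ℝ} (h0 : 0 < t) (h1 : t < π) : ∃ p, π / 2 - arctan p = t :=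
  ⟨tan (π / 2 - t), by rw [arctan_tan (by linarith) (by linarith)]; ring⟩

lemma sum_arccot_aux {ι : Type*} {a b : ℝ} (ha : 0 ≤ a) (hb : 0 ≤ b) (hab : a + b = 1)
    (x y : ι → ℝ) (s : Finset ι) (hs : s.Nonempty) : ∀ p q : ℝ,
    ∑ i ∈ s, (π / 2 - arctan (x i)) ≤ π / 2 - arctan p →
    ∑ i ∈ s, (π / 2 - arctan (y i)) ≤ π / 2 - arctan q →
    ∑ i ∈ s, (π / 2 - arctan (a * x i + b * y i)) ≤ π / 2 - arctan (a * p + b * q) := by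
  induction hs using Finset.Nonempty.cons_induction with
  | singleton j =>
    intro p q hp hq
    simp only [Finset.sum_singleton, sub_le_sub_iff_left, arctan_strictMono.le_iff_le] at *
    gcongr
  | cons j s hj hs ih =>
    intro p q hp hq
    rw [Finset.sum_cons] at *
    have pos : ∀ z : ι → ℝ, 0 < ∑ i ∈ s, (π / 2 - arctan (z i)) := fun z =>
      Finset.sum_pos (fun i _ => by linarith [arctan_lt_pi_div_two (z i)]) hs
    obtain ⟨p', hp'⟩ := exists_arccot (t := (π / 2 - arctan p) - (π / 2 - arctan (x j)))
      (by linarith [pos x])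
      (by linarith [neg_pi_div_two_lt_arctan p, arctan_lt_pi_div_two (x j)])
    obtain ⟨q', hq'⟩ := exists_arccot (t := (π / 2 - arctan q) - (π / 2 - arctan (y j)))
      (by linarith [pos y])
      (by linarith [neg_pi_div_two_lt_arctan q, arctan_lt_pi_div_two (y j)])
    have h1 := ih p' q' (by linarith) (by linarith)
    have h2 := two_var_aux (u₁ := p') (v₁ := x j) (w₁ := p) (u₂ := q') (v₂ := y j) (w₂ := q)
      ha hb hab (by linarith) (by linarith)
    linarith

/-- For `(n−2)π/2 < σ < nπ/2`, the superlevel set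
`Γ^σ = {κ : ∑ᵢ arctan κᵢ > σ}` is convex. -/
theorem statement5 (n : ℕ) (hn : 2 ≤ n) (σ : ℝ)
    (hσ1 : ((n : ℝ) - 2) * π / 2 < σ) (hσ2 : σ < (n : ℝ) * π / 2) :
    Convex ℝ {κ : Fin n → ℝ | σ < ∑ i, Real.arctan (κ i)} := by
  intro x hx y hy a b ha hb hab
  simp only [Set.mem_setOf_eq, Pi.add_apply, Pi.smul_apply, smul_eq_mul] at *
  have hne : (Finset.univ : Finset (Fin n)).Nonempty := ⟨⟨0, by omega⟩, Finset.mem_univ _⟩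
  have hsum : ∀ z : Fin n → ℝ, ∑ i, (π / 2 - arctan (z i)) = n * π / 2 - ∑ i, arctan (z i) := by
    intro z
    rw [Finset.sum_sub_distrib]
    simp
    ring
  have pos : 0 < ∑ i, (π / 2 - arctan (x i)) :=
    Finset.sum_pos (fun i _ => by linarith [arctan_lt_pi_div_two (x i)]) hne
  rw [hsum] at pos
  have hm : σ < min (∑ i, arctan (x i)) (∑ i, arctan (y i)) := lt_min hx hy
  have hmx := min_le_left (∑ i, arctan (x i)) (∑ i, arctan (y i))
  have hmy := min_le_right (∑ i, arctan (x i)) (∑ i, arctan (y i))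
  generalize min (∑ i, arctan (x i)) (∑ i, arctan (y i)) = m at *
  obtain ⟨p, hp⟩ := exists_arccot (t := n * π / 2 - m) (by linarith) (by linarith)
  have h := sum_arccot_aux ha hb hab x y Finset.univ hne p p
    (by rw [hsum]; linarith) (by rw [hsum]; linarith)
  rw [hsum (fun i => a * x i + b * y i), ← add_mul, hab, one_mul] at h
  linarith
end

section
/- Let n ≥ 2 and 0 < δ < π/2. There exists a constant A > 0, depending only on δ and n, such that the function G(κ) = −e^{−A F(κ)}, where F(κ) = ∑_{i=1}^n arctan κᵢ, is concave on the convex set {κ ∈ ℝⁿ : ∑_{i=1}^n arctan κᵢ ≥ (n−2)π/2 + δ}. -/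
open Real

lemma arctan_subadd {x y : ℝ} (hx : 0 ≤ x) (hy : 0 ≤ y) :
    arctan (x + y) ≤ arctan x + arctan y := by
  rcases lt_or_ge (x * y) 1 with h | h
  · rw [Real.arctan_add h]
    apply Real.arctan_strictMono.monotone
    rw [le_div_iff₀ (by linarith)]
    nlinarith [mul_nonneg (add_nonneg hx hy) (mul_nonneg hx hy)]
  · have hx0 : 0 < x := by
      rcases hx.eq_or_lt with h0 | h0
      · rw [← h0] at h; norm_num at h
      · exact h0
    have h1 := Real.arctan_inv_of_pos hx0
    have h2 : arctan x⁻¹ ≤ arctan y := by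
      apply Real.arctan_strictMono.monotone
      rw [inv_le_iff_one_le_mul₀ hx0]; linarith
    linarith [Real.arctan_lt_pi_div_two (x + y)]

lemma arctan_sum_subadd {ι : Type*} (s : Finset ι) (w : ι → ℝ) (hw : ∀ i ∈ s, 0 ≤ w i) :
    arctan (∑ i ∈ s, w i) ≤ ∑ i ∈ s, arctan (w i) := by
  classical
  induction s using Finset.induction_on with
  | empty => simp
  | insert a s ha ih =>
    rw [Finset.sum_insert ha, Finset.sum_insert ha]
    have h1 := ih (fun i hi => hw i (Finset.mem_insert_of_mem hi))
    have h2 := arctan_subadd (hw a (Finset.mem_insert_self a s))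
      (Finset.sum_nonneg (fun i hi => hw i (Finset.mem_insert_of_mem hi)))
    linarith

lemma quad_ineq {c t A σ η P s : ℝ} (hc : 0 < c) (ht : 0 < t) (htT : t ≤ c⁻¹)
    (hA : A = 2 * c⁻¹ * (c⁻¹ + c) / c) (hs : 0 < s) (hu : c + t ≤ s⁻¹)
    (hP : σ ^ 2 ≤ P * s) : 0 ≤ 2 * P - 2 * t * η ^ 2 + A * (σ + η) ^ 2 := by
  have hA' : 2 * t * (t + c) / c ≤ A := by
    rw [hA]; gcongr
  have hP' : (c + t) * σ ^ 2 ≤ P := by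
    calc (c + t) * σ ^ 2 ≤ s⁻¹ * σ ^ 2 := by gcongr
      _ ≤ s⁻¹ * (P * s) := by gcongr
      _ = P := by field_simp
  have h1 : 2 * t * (t + c) / c * (σ + η) ^ 2 ≤ A * (σ + η) ^ 2 := by gcongr
  have h2 : 2 * ((c + t) * σ ^ 2) - 2 * t * η ^ 2 + 2 * t * (t + c) / c * (σ + η) ^ 2
      = 2 * c * (σ + t * (σ + η) / c) ^ 2 := by
    field_simp; ring
  have h3 : 0 ≤ 2 * c * (σ + t * (σ + η) / c) ^ 2 := by positivity
  linarith

lemma pointwise (n : ℕ) (hn : 2 ≤ n) (δ : ℝ) (hδ0 : 0 < δ) (hδ1 : δ < π / 2) (A : ℝ)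
    (hA : A = 2 * (tan δ)⁻¹ * ((tan δ)⁻¹ + tan δ) / tan δ) (κ η : Fin n → ℝ)
    (hκ : ((n : ℝ) - 2) * π / 2 + δ ≤ ∑ i, Real.arctan (κ i)) :
    0 ≤ ∑ i, 2 * κ i * η i ^ 2 + A * (∑ i, η i) ^ 2 := by
  have hc : 0 < tan δ := Real.tan_pos_of_pos_of_lt_pi_div_two hδ0 hδ1
  have hA0 : 0 < A := by rw [hA]; positivity
  by_cases hall : ∀ i, 0 ≤ κ i
  · have : 0 ≤ ∑ i, 2 * κ i * η i ^ 2 :=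
      Finset.sum_nonneg (fun i _ => by have := hall i; positivity)
    positivity
  push Not at hall
  obtain ⟨j, hj⟩ := hall
  set E := Finset.univ.erase j with hE
  have hjm : j ∈ (Finset.univ : Finset (Fin n)) := Finset.mem_univ j
  have hcard : (E.card : ℝ) = n - 1 := by
    rw [hE, Finset.card_erase_of_mem hjm, Finset.card_univ, Fintype.card_fin,
      Nat.cast_sub (by omega)]; simp
  have hEne : E.Nonempty := by
    rw [← Finset.card_pos]
    have : (2 : ℝ) ≤ n := by exact_mod_cast hn
    have : (0 : ℝ) < E.card := by rw [hcard]; linarith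
    exact_mod_cast this
  have hδa : arctan (tan δ) = δ := Real.arctan_tan (by linarith) hδ1
  have hsumα : ∑ i ∈ E, (π / 2 - arctan (κ i)) ≤ π / 2 - δ - arctan (-κ j) := by
    rw [Finset.sum_sub_distrib, Finset.sum_const, nsmul_eq_mul, hcard, Real.arctan_neg]
    have := Finset.add_sum_erase Finset.univ (fun i => arctan (κ i)) hjm
    beta_reduce at this
    rw [← hE] at this
    linarith
  have htpos : 0 < arctan (-κ j) := by rw [Real.arctan_pos]; linarith
  have hκpos : ∀ i ∈ E, 0 < κ i := by
    intro i hi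
    have h1 := Finset.single_le_sum (f := fun i => π / 2 - arctan (κ i))
      (fun k _ => by have := Real.arctan_lt_pi_div_two (κ k); linarith) hi
    beta_reduce at h1
    rw [← Real.arctan_pos]
    linarith
  have hsumα' : ∑ i ∈ E, arctan (κ i)⁻¹ ≤ π / 2 - δ - arctan (-κ j) := by
    refine le_trans (le_of_eq ?_) hsumα
    exact Finset.sum_congr rfl (fun i hi => Real.arctan_inv_of_pos (hκpos i hi))
  have hs : 0 < ∑ i ∈ E, (κ i)⁻¹ :=
    Finset.sum_pos (fun i hi => inv_pos.2 (hκpos i hi)) hEne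
  have harc := arctan_sum_subadd E (fun i => (κ i)⁻¹)
    (fun i hi => (inv_pos.2 (hκpos i hi)).le)
  have hinv := Real.arctan_inv_of_pos hs
  have hu : tan δ + -κ j ≤ (∑ i ∈ E, (κ i)⁻¹)⁻¹ := by
    rw [← Real.arctan_strictMono.le_iff_le, hinv]
    have := arctan_subadd hc.le (by linarith : 0 ≤ -κ j)
    rw [hδa] at this
    linarith
  have htT : -κ j ≤ (tan δ)⁻¹ := by
    rw [← Real.arctan_strictMono.le_iff_le, Real.arctan_inv_of_pos hc, hδa]
    have := Real.arctan_pos.2 hs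
    linarith
  have hP : (∑ i ∈ E, η i) ^ 2 ≤ (∑ i ∈ E, κ i * η i ^ 2) * ∑ i ∈ E, (κ i)⁻¹ := by
    apply Finset.sum_sq_le_sum_mul_sum_of_sq_eq_mul
    · intro i hi; have := hκpos i hi; positivity
    · intro i hi; have := hκpos i hi; positivity
    · intro i hi; have := hκpos i hi; field_simp
  have := quad_ineq (η := η j) hc (by linarith : 0 < -κ j) htT hA hs hu hP
  rw [← Finset.add_sum_erase Finset.univ (fun i => 2 * κ i * η i ^ 2) hjm,
    ← Finset.add_sum_erase Finset.univ η hjm, ← hE]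
  have h2 : ∑ i ∈ E, 2 * κ i * η i ^ 2 = 2 * ∑ i ∈ E, κ i * η i ^ 2 := by
    rw [Finset.mul_sum]; exact Finset.sum_congr rfl (fun i _ => by ring)
  rw [h2]
  convert this using 1
  ring

lemma line_concave (n : ℕ) (hn : 2 ≤ n) (δ : ℝ) (hδ0 : 0 < δ) (hδ1 : δ < π / 2) (A : ℝ)
    (hA : A = 2 * (tan δ)⁻¹ * ((tan δ)⁻¹ + tan δ) / tan δ) (x v : Fin n → ℝ)
    (h : ∀ τ ∈ Set.Icc (0:ℝ) 1,
      ((n : ℝ) - 2) * π / 2 + δ ≤ ∑ i, Real.arctan (x i + τ * v i)) :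
    ConcaveOn ℝ (Set.Icc (0:ℝ) 1)
      (fun τ => -Real.exp (-A * ∑ i, Real.arctan (x i + τ * v i))) := by
  have hc : 0 < tan δ := Real.tan_pos_of_pos_of_lt_pi_div_two hδ0 hδ1
  have hA0 : 0 < A := by rw [hA]; positivity
  have hl : ∀ i τ, HasDerivAt (fun τ : ℝ => x i + τ * v i) (v i) τ := by
    intro i τ
    simpa using ((hasDerivAt_id τ).mul_const (v i)).const_add (x i)
  have hF : ∀ τ : ℝ, HasDerivAt (fun τ : ℝ => ∑ i, Real.arctan (x i + τ * v i))
      (∑ i, v i / (1 + (x i + τ * v i) ^ 2)) τ := by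
    intro τ
    apply HasDerivAt.fun_sum
    intro i _
    refine (hl i τ).arctan.congr_deriv ?_
    ring
  have hF' : ∀ τ : ℝ, HasDerivAt (fun τ : ℝ => ∑ i, v i / (1 + (x i + τ * v i) ^ 2))
      (-∑ i, 2 * (x i + τ * v i) * (v i / (1 + (x i + τ * v i) ^ 2)) ^ 2) τ := by
    intro τ
    rw [← Finset.sum_neg_distrib]
    apply HasDerivAt.fun_sum
    intro i _
    have hne : 1 + (x i + τ * v i) ^ 2 ≠ 0 := by positivity
    refine ((hasDerivAt_const τ (v i)).fun_div (((hl i τ).fun_pow 2).const_add 1) hne).congr_deriv ?_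
    field_simp
    simp
    try ring
  have hG : ∀ τ : ℝ, HasDerivAt (fun τ => -Real.exp (-A * ∑ i, Real.arctan (x i + τ * v i)))
      (A * Real.exp (-A * ∑ i, Real.arctan (x i + τ * v i)) *
        ∑ i, v i / (1 + (x i + τ * v i) ^ 2)) τ := by
    intro τ
    refine (((hF τ).const_mul (-A)).exp).fun_neg.congr_deriv ?_
    ring
  have hG' : ∀ τ : ℝ, HasDerivAt (fun τ => A * Real.exp (-A * ∑ i, Real.arctan (x i + τ * v i)) *
        ∑ i, v i / (1 + (x i + τ * v i) ^ 2))
      (-(A * Real.exp (-A * ∑ i, Real.arctan (x i + τ * v i)) *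
        (∑ i, 2 * (x i + τ * v i) * (v i / (1 + (x i + τ * v i) ^ 2)) ^ 2
          + A * (∑ i, v i / (1 + (x i + τ * v i) ^ 2)) ^ 2))) τ := by
    intro τ
    refine (((((hF τ).const_mul (-A)).exp).const_mul A).fun_mul (hF' τ)).congr_deriv ?_
    ring
  refine concaveOn_of_hasDerivWithinAt2_nonpos (convex_Icc 0 1)
    (fun τ _ => (hG τ).continuousAt.continuousWithinAt)
    (fun τ _ => (hG τ).hasDerivWithinAt) (fun τ _ => (hG' τ).hasDerivWithinAt) ?_
  intro τ hτ
  have := pointwise n hn δ hδ0 hδ1 A hA (fun i => x i + τ * v i)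
    (fun i => v i / (1 + (x i + τ * v i) ^ 2)) (h τ (interior_subset hτ))
  have h2 := Real.exp_pos (-A * ∑ i, Real.arctan (x i + τ * v i))
  beta_reduce at this
  rw [neg_nonpos]
  positivity

lemma segment_mem (n : ℕ) (hn : 2 ≤ n) (δ : ℝ) (hδ0 : 0 < δ) (hδ1 : δ < π / 2)
    (x v : Fin n → ℝ)
    (h0 : ((n : ℝ) - 2) * π / 2 + δ ≤ ∑ i, Real.arctan (x i))
    (h1 : ((n : ℝ) - 2) * π / 2 + δ ≤ ∑ i, Real.arctan (x i + v i)) :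
    ∀ τ ∈ Set.Icc (0:ℝ) 1,
      ((n : ℝ) - 2) * π / 2 + δ ≤ ∑ i, Real.arctan (x i + τ * v i) := by
  have hc : 0 < tan δ := Real.tan_pos_of_pos_of_lt_pi_div_two hδ0 hδ1
  obtain ⟨A, hA⟩ : ∃ A, A = 2 * (tan δ)⁻¹ * ((tan δ)⁻¹ + tan δ) / tan δ := ⟨_, rfl⟩
  have hA0 : 0 < A := by rw [hA]; positivity
  have hn0 : (0:ℝ) < n := by exact_mod_cast (by omega : 0 < n)
  haveI : Nonempty (Fin n) := ⟨⟨0, by omega⟩⟩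
  set c := ((n : ℝ) - 2) * π / 2 + δ with hcdef
  have hmono : ∀ (τ s s' : ℝ), s < s' → ∑ i, Real.arctan ((x i + s) + τ * v i) <
      ∑ i, Real.arctan ((x i + s') + τ * v i) := by
    intro τ s s' hs
    apply Finset.sum_lt_sum_of_nonempty Finset.univ_nonempty
    intro i _
    apply Real.arctan_strictMono
    linarith
  have hcont : Continuous (fun p : ℝ × ℝ => ∑ i, Real.arctan ((x i + p.1) + p.2 * v i)) := by
    fun_prop
  by_contra hcon
  push Not at hcon
  obtain ⟨τ₀, hτ₀, hlt⟩ := hcon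
  -- a large shift
  have hK : ∃ K, c / n < arctan K := by
    have : c / n < π / 2 := by
      rw [div_lt_iff₀ hn0, hcdef]; nlinarith [Real.pi_pos]
    have h2 := (Real.tendsto_arctan_atTop.mono_right nhdsWithin_le_nhds).eventually
      (lt_mem_nhds this)
    exact h2.exists
  obtain ⟨K, hK⟩ := hK
  obtain ⟨M, hM0, hM⟩ : ∃ M : ℝ, 0 ≤ M ∧ ∀ τ ∈ Set.Icc (0:ℝ) 1, c < ∑ i, Real.arctan ((x i + M) + τ * v i) := by
    refine ⟨|K| + ∑ i, (|x i| + |v i|), by positivity, ?_⟩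
    intro τ hτ
    have : ∑ i : Fin n, c / n = c := by
      simp; field_simp
    rw [← this]
    apply Finset.sum_lt_sum_of_nonempty Finset.univ_nonempty
    intro i _
    refine hK.trans_le (Real.arctan_strictMono.monotone ?_)
    have h2 := Finset.single_le_sum (f := fun i => |x i| + |v i|)
      (fun k _ => by positivity) (Finset.mem_univ i)
    beta_reduce at h2
    have h3 : -|v i| ≤ τ * v i := by
      have h4 : |τ * v i| ≤ |v i| := by
        rw [abs_mul, abs_of_nonneg hτ.1]
        exact mul_le_of_le_one_left (abs_nonneg _) hτ.2
      linarith [neg_abs_le (τ * v i)]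
    linarith [neg_abs_le (x i), le_abs_self K]
  have hcomp : IsCompact ((Set.Icc (0:ℝ) M ×ˢ Set.Icc (0:ℝ) 1) ∩
      {p : ℝ × ℝ | ∑ i, Real.arctan ((x i + p.1) + p.2 * v i) ≤ c}) :=
    (isCompact_Icc.prod isCompact_Icc).inter_right (isClosed_le hcont continuous_const)
  obtain ⟨⟨s, τ⟩, ⟨⟨hsI, hτI⟩, hle⟩, hmax⟩ := hcomp.exists_isMaxOn
    ⟨(0, τ₀), ⟨⟨by simp [hM0], hτ₀⟩, by simpa using hlt.le⟩⟩ continuous_fst.continuousOn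
  simp only [Set.mem_setOf_eq] at hle hsI hτI
  have hsM : s < M := by
    rcases hsI.2.eq_or_lt with h | h
    · rw [h] at hle; linarith [hM τ hτI]
    · exact h
  have hseg : ∀ τ' ∈ Set.Icc (0:ℝ) 1, c ≤ ∑ i, Real.arctan ((x i + s) + τ' * v i) := by
    intro τ' hτ'
    by_contra hh
    push Not at hh
    have hcs : ContinuousOn (fun r : ℝ => ∑ i, Real.arctan ((x i + r) + τ' * v i))
      (Set.Icc s M) := by fun_prop
    obtain ⟨r, hr, hrc⟩ := intermediate_value_Icc hsM.le hcs ⟨hh.le, (hM τ' hτ').le⟩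
    beta_reduce at hrc
    have hrs : r ≤ s := hmax (a := (r, τ')) ⟨⟨⟨hsI.1.trans hr.1, hr.2⟩, hτ'⟩, hrc.le⟩
    have : r = s := le_antisymm hrs hr.1
    rw [this] at hrc
    linarith
  have hconc := line_concave n hn δ hδ0 hδ1 A hA (fun i => x i + s) v hseg
  have hmin := hconc.min_le_of_mem_Icc (Set.left_mem_Icc.2 zero_le_one)
    (Set.right_mem_Icc.2 zero_le_one) hτI
  have key : ∀ a b : ℝ, -Real.exp (-A * a) ≤ -Real.exp (-A * b) → a ≤ b := by
    intro a b hab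
    rw [neg_le_neg_iff, Real.exp_le_exp] at hab
    nlinarith
  -- the shift is strictly positive unless the minimum sits at s = 0 on the original segment
  have hspos : 0 < s := by
    rcases hsI.1.eq_or_lt with h | h
    · have := hseg τ₀ hτ₀
      rw [← h] at this
      simp only [add_zero] at this
      linarith
    · exact h
  have e0 := hmono 0 0 s hspos
  have e1 := hmono 1 0 s hspos
  simp only [add_zero, zero_mul, one_mul] at e0 e1
  rcases min_le_iff.1 hmin with h | h
  · have := key _ _ h
    simp only [add_zero, zero_mul] at this
    linarith
  · have := key _ _ h
    simp only [one_mul] at this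
    linarith

/-- There is `A > 0`, depending only on `δ` and `n`, such that
`G(κ) = −exp(−A ∑ᵢ arctan κᵢ)` is concave on
`{κ : ∑ᵢ arctan κᵢ ≥ (n−2)π/2 + δ}`. -/
theorem statement6 (n : ℕ) (hn : 2 ≤ n) (δ : ℝ) (hδ0 : 0 < δ) (hδ1 : δ < π / 2) :
    ∃ A : ℝ, 0 < A ∧
      ConcaveOn ℝ {κ : Fin n → ℝ | ((n : ℝ) - 2) * π / 2 + δ ≤ ∑ i, Real.arctan (κ i)}
        (fun κ => -Real.exp (-A * ∑ i, Real.arctan (κ i))) := by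
  have hc : 0 < tan δ := Real.tan_pos_of_pos_of_lt_pi_div_two hδ0 hδ1
  refine ⟨2 * (tan δ)⁻¹ * ((tan δ)⁻¹ + tan δ) / tan δ, by positivity, ?_, ?_⟩
  · intro x hx y hy a b ha hb hab
    simp only [Set.mem_setOf_eq] at hx hy ⊢
    have h := segment_mem n hn δ hδ0 hδ1 x (fun i => y i - x i) hx (by simpa using hy) b
      ⟨hb, by linarith⟩
    refine h.trans (le_of_eq (Finset.sum_congr rfl (fun i _ => ?_)))
    congr 1
    simp only [Pi.add_apply, Pi.smul_apply, smul_eq_mul]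
    rw [← eq_sub_iff_add_eq] at hab
    rw [hab]; ring
  · intro x hx y hy a b ha hb hab
    simp only [Set.mem_setOf_eq] at hx hy
    have h := segment_mem n hn δ hδ0 hδ1 x (fun i => y i - x i) hx (by simpa using hy)
    have hl := line_concave n hn δ hδ0 hδ1 _ rfl x (fun i => y i - x i) h
    have h2 := hl.2 (Set.left_mem_Icc.2 zero_le_one) (Set.right_mem_Icc.2 zero_le_one) ha hb hab
    have h3 : ∀ i, (a • x + b • y) i = x i + b * (y i - x i) := by
      intro i
      simp only [Pi.add_apply, Pi.smul_apply, smul_eq_mul]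
      rw [← eq_sub_iff_add_eq] at hab
      rw [hab]; ring
    simp only [h3]
    simpa using h2
end

section
/- Let n ≥ 2 and 0 < δ < π/2, and set Γ = {M ∈ Sym(n,ℝ) : ∑_{i=1}^n arctan λᵢ(M) ≥ (n−2)π/2 + δ}, where λ₁(M),…,λₙ(M) are the eigenvalues of the real symmetric matrix M. There exists A = A(δ) > 0 such that the operator G(M) = −e^{−A ∑ᵢ arctan λᵢ(M)} is concave on Γ and elliptic on Γ, i.e. for every M ∈ Γ the derivative [∂G/∂m_{ij}(M)] is a positive definite matrix (equivalently, G is strictly monotone with respect to the ordering of symmetric matrices). -/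
open Real

noncomputable section

open Classical in
/-- The sum `∑ᵢ arctan λᵢ(M)` of arctangents of the eigenvalues of a symmetric matrix. -/
def sumArctanEig {n : ℕ} (M : Matrix (Fin n) (Fin n) ℝ) : ℝ :=
  if h : M.IsHermitian then ∑ i, Real.arctan (h.eigenvalues i) else 0


lemma arctan_two (x p : ℝ) (h : 0 < x + p) :
    arctan x + arctan p = π / 2 + arctan ((x * p - 1) / (x + p)) := by
  have h1 : arctan (-p) < arctan x := arctan_strictMono (by linarith)
  rw [arctan_neg] at h1
  have hx := arctan_lt_pi_div_two x
  have hp := arctan_lt_pi_div_two p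
  have key : arctan ((x * p - 1) / (x + p)) = arctan x + arctan p - π / 2 := by
    apply arctan_eq_of_tan_eq
    · rw [tan_eq_sin_div_cos, sin_sub_pi_div_two, cos_sub_pi_div_two, sin_add, cos_add,
        sin_arctan, sin_arctan, cos_arctan, cos_arctan]
      have a1 : 0 < √(1 + x ^ 2) := by positivity
      have a2 : 0 < √(1 + p ^ 2) := by positivity
      have : x / √(1 + x ^ 2) * (1 / √(1 + p ^ 2)) + 1 / √(1 + x ^ 2) * (p / √(1 + p ^ 2))
        = (x + p) / (√(1 + x ^ 2) * √(1 + p ^ 2)) := by field_simp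
      rw [this]
      field_simp
      ring
    · constructor <;> linarith
  linarith

lemma pos_of_arctan (x p z : ℝ) (h : arctan x + arctan p = π / 2 + arctan z) : 0 < x + p := by
  have := neg_pi_div_two_lt_arctan z
  have h2 : arctan (-p) < arctan x := by rw [arctan_neg]; linarith
  have := arctan_lt_arctan_iff.1 h2
  linarith

lemma two_var (x y p q z w a b : ℝ) (ha : 0 ≤ a) (hb : 0 ≤ b) (hab : a + b = 1)
    (h1 : arctan x + arctan p = π / 2 + arctan z) (h2 : arctan y + arctan q = π / 2 + arctan w) :
    π / 2 + arctan (a * z + b * w) ≤ arctan (a * x + b * y) + arctan (a * p + b * q) := by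
  have s1 := pos_of_arctan _ _ _ h1
  have s2 := pos_of_arctan _ _ _ h2
  have e1 : z = (x * p - 1) / (x + p) := by
    rw [arctan_two x p s1] at h1; exact (arctan_injective (by linarith)).symm
  have e2 : w = (y * q - 1) / (y + q) := by
    rw [arctan_two y q s2] at h2; exact (arctan_injective (by linarith)).symm
  have s3 : 0 < (a * x + b * y) + (a * p + b * q) := by
    have : 0 < a ∨ 0 < b := by
      by_contra hc; push Not at hc; linarith
    have e : (a * x + b * y) + (a * p + b * q) = a * (x + p) + b * (y + q) := by ring
    rw [e]
    rcases this with h | h <;> positivity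
  rw [arctan_two _ _ s3]
  gcongr
  rw [le_div_iff₀ s3]
  have f1 : z * (x + p) = x * p - 1 := by rw [e1]; field_simp
  have f2 : w * (y + q) = y * q - 1 := by rw [e2]; field_simp
  have hb' : b = 1 - a := by linarith
  have main : 0 ≤ x * q + y * p - 2 - z * (y + q) - w * (x + p) := by
    have : x * q + y * p - 2 - z * (y + q) - w * (x + p)
      = ((x * (y + q) - y * (x + p)) ^ 2 + ((x + p) - (y + q)) ^ 2) / ((x + p) * (y + q)) := by
      rw [e1, e2]; field_simp; ring
    rw [this]; positivity
  have hh := mul_nonneg (mul_nonneg ha hb) main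
  have : (a * x + b * y) * (a * p + b * q) - 1 - (a * z + b * w) * (a * x + b * y + (a * p + b * q))
     = a * b * (x * q + y * p - 2 - z * (y + q) - w * (x + p))
       - a ^ 2 * (z * (x + p) - (x * p - 1)) - b ^ 2 * (w * (y + q) - (y * q - 1)) 
       + ((a + b) ^ 2 - 1) := by ring
  rw [f1, f2, hab] at this
  nlinarith

lemma multi_var {ι : Type*} [DecidableEq ι] (x y : ι → ℝ) (a b : ℝ) (ha : 0 ≤ a) (hb : 0 ≤ b)
    (hab : a + b = 1) (s : Finset ι) : ∀ z w : ℝ,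
    ∑ i ∈ s, (π / 2 - arctan (x i)) ≤ π / 2 - arctan z →
    ∑ i ∈ s, (π / 2 - arctan (y i)) ≤ π / 2 - arctan w →
    ∑ i ∈ s, (π / 2 - arctan (a * x i + b * y i)) ≤ π / 2 - arctan (a * z + b * w) := by
  induction s using Finset.induction_on with
  | empty => 
    intro z w _ _
    have := arctan_lt_pi_div_two (a * z + b * w)
    simp; linarith
  | insert i s hi ih =>
    intro z w hz hw
    rw [Finset.sum_insert hi] at *
    rcases s.eq_empty_or_nonempty with rfl | hs
    · simp only [Finset.sum_empty, add_zero] at *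
      have h1 := arctan_le_arctan_iff.1 (show arctan z ≤ arctan (x i) by linarith)
      have h2 := arctan_le_arctan_iff.1 (show arctan w ≤ arctan (y i) by linarith)
      have : arctan (a * z + b * w) ≤ arctan (a * x i + b * y i) := by gcongr
      linarith
    · have key : ∀ (u : ι → ℝ) (z : ℝ), (π / 2 - arctan (u i)) + ∑ j ∈ s, (π / 2 - arctan (u j))
          ≤ π / 2 - arctan z → ∃ p, arctan (u i) + arctan p = π / 2 + arctan z ∧
          ∑ j ∈ s, (π / 2 - arctan (u j)) ≤ π / 2 - arctan p := by
        intro u z h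
        have hpos : 0 < ∑ j ∈ s, (π / 2 - arctan (u j)) :=
          Finset.sum_pos (fun j _ => by linarith [arctan_lt_pi_div_two (u j)]) hs
        have h3 := arctan_lt_pi_div_two (u i)
        have h4 := neg_pi_div_two_lt_arctan z
        refine ⟨tan (π / 2 + arctan z - arctan (u i)), ?_, ?_⟩ <;>
        rw [arctan_tan (by linarith) (by linarith)] <;> linarith
      obtain ⟨p, hp1, hp2⟩ := key x z hz
      obtain ⟨q, hq1, hq2⟩ := key y w hw
      have A := ih p q hp2 hq2
      have B := two_var _ _ _ _ _ _ a b ha hb hab hp1 hq1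
      linarith

lemma one_var (A κ z0 : ℝ) (hA : 0 < A) (hz : -A ≤ 2 * z0) :
    ConcaveOn ℝ (Set.Ici z0) (fun z => -exp (-A * (κ + arctan z))) := by
  have d1 : ∀ z : ℝ, HasDerivAt (fun z => -exp (-A * (κ + arctan z)))
      (A * (exp (-A * (κ + arctan z)) * (1 + z ^ 2)⁻¹)) z := by
    intro z
    have := ((((hasDerivAt_arctan' z).const_add κ).const_mul (-A)).exp).neg
    refine HasDerivAt.congr_deriv (f' := _) this ?_
    ring
  have d2 : ∀ z : ℝ, HasDerivAt (fun z => A * (exp (-A * (κ + arctan z)) * (1 + z ^ 2)⁻¹))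
      (-(A * (A + 2 * z)) * exp (-A * (κ + arctan z)) * ((1 + z ^ 2)⁻¹) ^ 2) z := by
    intro z
    have hne : (1 + z ^ 2) ≠ 0 := by positivity
    have e := ((((hasDerivAt_arctan' z).const_add κ).const_mul (-A)).exp)
    have e2 := (((hasDerivAt_id z).pow 2).const_add 1).inv hne
    have := (e.mul e2).const_mul A
    refine HasDerivAt.congr_deriv (f' := _) this ?_
    simp
    field_simp
    ring
  apply concaveOn_of_hasDerivWithinAt2_nonpos (convex_Ici z0) 
    (fun z _ => (d1 z).continuousAt.continuousWithinAt)
    (fun z _ => (d1 z).hasDerivWithinAt) (fun z _ => (d2 z).hasDerivWithinAt)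
  intro z hz'
  rw [interior_Ici] at hz'
  have : z0 < z := hz'
  have : 0 ≤ A * (A + 2 * z) := mul_nonneg hA.le (by linarith)
  have : 0 ≤ (A * (A + 2 * z)) * exp (-A * (κ + arctan z)) * ((1 + z ^ 2)⁻¹) ^ 2 := by positivity
  linarith

lemma vec_concave (n : ℕ) (hn : 2 ≤ n) (δ : ℝ) (hδ0 : 0 < δ) (hδ1 : δ < π / 2) :
    ∃ A : ℝ, 0 < A ∧ ConcaveOn ℝ {x : Fin n → ℝ | ((n : ℝ) - 2) * π / 2 + δ ≤ ∑ i, arctan (x i)}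
      (fun x => -exp (-A * ∑ i, arctan (x i))) := by
  set z0 := tan (δ - π / 2) with hz0
  have hz0' : arctan z0 = δ - π / 2 := arctan_tan (by linarith) (by linarith)
  have hsum : ∀ x : Fin n → ℝ, ∑ i, (π / 2 - arctan (x i)) = n * (π / 2) - ∑ i, arctan (x i) := by
    intro x; simp [Finset.sum_sub_distrib]
  have key : ∀ x : Fin n → ℝ, ((n : ℝ) - 2) * π / 2 + δ ≤ ∑ i, arctan (x i) → 
      ∃ z, z0 ≤ z ∧ ∑ i, arctan (x i) = ((n : ℝ) - 1) * (π / 2) + arctan z := by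
    intro x hx
    have hpos : 0 < ∑ i, (π / 2 - arctan (x i)) :=
      Finset.sum_pos (fun j _ => by linarith [arctan_lt_pi_div_two (x j)]) 
        ⟨⟨0, by omega⟩, Finset.mem_univ _⟩
    rw [hsum] at hpos
    have e : arctan (tan (∑ i, arctan (x i) - ((n : ℝ) - 1) * (π / 2))) 
      = ∑ i, arctan (x i) - ((n : ℝ) - 1) * (π / 2) := arctan_tan (by linarith) (by linarith)
    refine ⟨tan (∑ i, arctan (x i) - ((n : ℝ) - 1) * (π / 2)), ?_, ?_⟩
    · rw [← arctan_le_arctan_iff, e, hz0']; linarith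
    · rw [e]; ring
  have main : ∀ x y : Fin n → ℝ, ∀ a b : ℝ, 0 ≤ a → 0 ≤ b → a + b = 1 → ∀ z w,
      ∑ i, arctan (x i) = ((n : ℝ) - 1) * (π / 2) + arctan z → 
      ∑ i, arctan (y i) = ((n : ℝ) - 1) * (π / 2) + arctan w → 
      ((n : ℝ) - 1) * (π / 2) + arctan (a * z + b * w) ≤ ∑ i, arctan ((a • x + b • y) i) := by
    intro x y a b ha hb hab z w hz hw
    have := multi_var x y a b ha hb hab Finset.univ z w (by rw [hsum]; linarith)
      (by rw [hsum]; linarith)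
    have e := hsum (fun i => a * x i + b * y i)
    simp only [Pi.add_apply, Pi.smul_apply, smul_eq_mul]
    linarith
  have hA : 0 < 2 * |z0| + 1 := by positivity
  have hc := one_var (2 * |z0| + 1) (((n : ℝ) - 1) * (π / 2)) z0 hA
    (by linarith [neg_abs_le z0])
  refine ⟨2 * |z0| + 1, hA, ?_, ?_⟩
  · intro x hx y hy a b ha hb hab
    obtain ⟨z, hz, hz'⟩ := key x hx
    obtain ⟨w, hw, hw'⟩ := key y hy
    have := main x y a b ha hb hab z w hz' hw'
    have h1 : arctan z0 ≤ arctan (a * z + b * w) := arctan_mono (by 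
      calc z0 = a * z0 + b * z0 := by rw [← add_mul, hab, one_mul]
        _ ≤ _ := by gcongr)
    rw [hz0'] at h1
    simp only [Set.mem_ofPred_eq]
    linarith
  · intro x hx y hy a b ha hb hab
    obtain ⟨z, hz, hz'⟩ := key x hx
    obtain ⟨w, hw, hw'⟩ := key y hy
    have h1 := main x y a b ha hb hab z w hz' hw'
    have h2 := hc.2 hz hw ha hb hab
    simp only [smul_eq_mul] at h2 ⊢
    rw [hz', hw']
    refine h2.trans ?_
    rw [neg_le_neg_iff, exp_le_exp]
    nlinarith

lemma spec {n : ℕ} (M : Matrix (Fin n) (Fin n) ℝ) (h : M.IsHermitian) :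
    ∃ U : Matrix (Fin n) (Fin n) ℝ, U.transpose * U = 1 ∧ U * U.transpose = 1 ∧
      M = U * Matrix.diagonal h.eigenvalues * U.transpose := by
  refine ⟨h.eigenvectorUnitary, ?_, ?_, ?_⟩
  · have := Unitary.coe_star_mul_self h.eigenvectorUnitary
    simpa [Matrix.star_eq_conjTranspose, Matrix.conjTranspose_eq_transpose_of_trivial] using this
  · have := Unitary.coe_mul_star_self h.eigenvectorUnitary
    simpa [Matrix.star_eq_conjTranspose, Matrix.conjTranspose_eq_transpose_of_trivial] using this
  · have := h.spectral_theorem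
    rw [Unitary.conjStarAlgAut_apply] at this
    simpa [Matrix.star_eq_conjTranspose, Matrix.conjTranspose_eq_transpose_of_trivial] using this

open Matrix in
lemma quad {n : ℕ} (M U : Matrix (Fin n) (Fin n) ℝ) (l : Fin n → ℝ)
    (h : M = U * diagonal l * Uᵀ) (v : Fin n → ℝ) :
    v ⬝ᵥ (M *ᵥ v) = ∑ j, l j * ((Uᵀ *ᵥ v) j) ^ 2 := by
  rw [h, ← mulVec_mulVec, ← mulVec_mulVec, dotProduct_mulVec, ← mulVec_transpose]
  simp only [dotProduct, mulVec_diagonal]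
  exact Finset.sum_congr rfl fun j _ => by ring

open Matrix in
lemma quad1 {n : ℕ} (U : Matrix (Fin n) (Fin n) ℝ)
    (h : U * Uᵀ = 1) (v : Fin n → ℝ) :
    v ⬝ᵥ v = ∑ j, ((Uᵀ *ᵥ v) j) ^ 2 := by
  have := quad 1 U (fun _ => 1) (by rw [← h]; simp) v
  simpa using this

open Matrix in
lemma weyl {n : ℕ} (M N : Matrix (Fin n) (Fin n) ℝ) (hM : M.IsHermitian) (hN : N.IsHermitian)
    (h : (N - M).PosSemidef) (i : Fin n) : hM.eigenvalues i ≤ hN.eigenvalues i := by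
  obtain ⟨U, hU1, hU2, hU⟩ := spec M hM
  obtain ⟨V, hV1, hV2, hV⟩ := spec N hN
  set E : Fin n → Fin (Fintype.card (Fin n)) :=
    fun j => (Fintype.equivOfCardEq (Fintype.card_fin _) : Fin (Fintype.card (Fin n)) ≃ Fin n).symm j with hE
  have mM : ∀ j k, E j ≤ E k → hM.eigenvalues k ≤ hM.eigenvalues j :=
    fun j k hjk => hM.eigenvalues₀_antitone hjk
  have mN : ∀ j k, E j ≤ E k → hN.eigenvalues k ≤ hN.eigenvalues j :=
    fun j k hjk => hN.eigenvalues₀_antitone hjk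
  have hEinj : Function.Injective E := fun a b hab => Equiv.injective _ hab
  let L : (Fin n → ℝ) →ₗ[ℝ] ({j : Fin n // j ≠ i} → ℝ) :=
    LinearMap.pi fun j => if E i < E j.1 then (LinearMap.proj j.1).comp (Matrix.mulVecLin Uᵀ)
      else (LinearMap.proj j.1).comp (Matrix.mulVecLin Vᵀ)
  have hker : LinearMap.ker L ≠ ⊥ := by
    apply LinearMap.ker_ne_bot_of_finrank_lt
    have : 0 < n := i.pos
    simp
    omega
  obtain ⟨v, hv, hv0⟩ := (Submodule.ne_bot_iff _).1 hker
  have hv' : ∀ j, j ≠ i → (E i < E j → (Uᵀ *ᵥ v) j = 0) ∧ (¬ E i < E j → (Vᵀ *ᵥ v) j = 0) := by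
    intro j hj
    have := congrFun (LinearMap.mem_ker.1 hv) ⟨j, hj⟩
    simp only [L, LinearMap.pi_apply] at this
    constructor
    · intro hc; simpa [hc, Matrix.mulVec_transpose] using this
    · intro hc; simpa [hc, Matrix.mulVec_transpose] using this
  have vpos : 0 < v ⬝ᵥ v := by
    have : 0 ≤ v ⬝ᵥ v := Finset.sum_nonneg fun j _ => mul_self_nonneg _
    exact lt_of_le_of_ne this (fun hc => hv0 (dotProduct_self_eq_zero.1 hc.symm))
  have h1 : hM.eigenvalues i * (v ⬝ᵥ v) ≤ v ⬝ᵥ (M *ᵥ v) := by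
    rw [quad M U _ hU, quad1 U hU2, Finset.mul_sum]
    refine Finset.sum_le_sum fun j _ => ?_
    by_cases hj : E i < E j
    · have hji : j ≠ i := by rintro rfl; exact lt_irrefl _ hj
      simp [(hv' j hji).1 hj]
    · exact mul_le_mul_of_nonneg_right (mM _ _ (not_lt.1 hj)) (sq_nonneg _)
  have h2 : v ⬝ᵥ (N *ᵥ v) ≤ hN.eigenvalues i * (v ⬝ᵥ v) := by
    rw [quad N V _ hV, quad1 V hV2, Finset.mul_sum]
    refine Finset.sum_le_sum fun j _ => ?_
    by_cases hji : j = i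
    · rw [hji]
    by_cases hj : E i < E j
    · exact mul_le_mul_of_nonneg_right (mN _ _ hj.le) (sq_nonneg _)
    · simp [(hv' j hji).2 hj]
  have h3 : 0 ≤ v ⬝ᵥ ((N - M) *ᵥ v) := by simpa using h.dotProduct_mulVec_nonneg v
  rw [sub_mulVec, dotProduct_sub] at h3
  exact le_of_mul_le_mul_right (by linarith) vpos

open Matrix in
lemma strict {n : ℕ} (M N : Matrix (Fin n) (Fin n) ℝ) (hM : M.IsHermitian) (hN : N.IsHermitian)
    (h : (N - M).PosSemidef) (hne : N ≠ M) :
    ∑ i, arctan (hM.eigenvalues i) < ∑ i, arctan (hN.eigenvalues i) := by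
  have hw := weyl M N hM hN h
  apply Finset.sum_lt_sum (fun i _ => arctan_mono (hw i))
  by_contra hc
  push Not at hc
  have heq : ∀ i, hM.eigenvalues i = hN.eigenvalues i := fun i =>
    le_antisymm (hw i) (arctan_le_arctan_iff.1 (hc i (Finset.mem_univ i)))
  have t : (N - M).trace = 0 := by
    rw [trace_sub, hN.trace_eq_sum_eigenvalues, hM.trace_eq_sum_eigenvalues]
    simp [heq]
  exact hne (sub_eq_zero.1 (h.trace_eq_zero_iff.1 t))

open Matrix in
lemma diag_mem {n : ℕ} (U M : Matrix (Fin n) (Fin n) ℝ) (hM : M.IsHermitian)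
    (hU1 : Uᵀ * U = 1) (hU2 : U * Uᵀ = 1) : ∃ S ∈ doublyStochastic ℝ (Fin n),
      (fun i => (Uᵀ * M * U) i i) = S *ᵥ hM.eigenvalues := by
  obtain ⟨V, hV1, hV2, hV⟩ := spec M hM
  set W := Uᵀ * V with hW
  have w1 : W * Wᵀ = 1 := by
    rw [hW, transpose_mul, transpose_transpose, Matrix.mul_assoc, ← Matrix.mul_assoc V, hV2,
      Matrix.one_mul, hU1]
  have w2 : Wᵀ * W = 1 := by
    rw [hW, transpose_mul, transpose_transpose, Matrix.mul_assoc, ← Matrix.mul_assoc U, hU2,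
      Matrix.one_mul, hV1]
  refine ⟨Matrix.of fun i j => W i j ^ 2, ?_, ?_⟩
  · rw [mem_doublyStochastic_iff_sum]
    refine ⟨fun i j => sq_nonneg _, fun i => ?_, fun j => ?_⟩
    · have := congrFun (congrFun w1 i) i
      simpa [mul_apply, pow_two] using this
    · have := congrFun (congrFun w2 j) j
      simpa [mul_apply, pow_two] using this
  · have e : Uᵀ * M * U = W * diagonal hM.eigenvalues * Wᵀ := by
      conv_lhs => rw [hV]
      rw [hW, transpose_mul, transpose_transpose]; simp only [Matrix.mul_assoc]
    funext i
    rw [e, mul_apply]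
    simp only [mul_diagonal, transpose_apply, mulVec, dotProduct, of_apply]
    exact Finset.sum_congr rfl fun j _ => by ring

open Matrix in
lemma schur {n : ℕ} (K : Set (Fin n → ℝ)) (g : (Fin n → ℝ) → ℝ) (hg : ConcaveOn ℝ K g)
    (hK : ∀ x ∈ K, ∀ σ : Equiv.Perm (Fin n), x ∘ σ ∈ K)
    (hgs : ∀ x ∈ K, ∀ σ : Equiv.Perm (Fin n), g (x ∘ σ) = g x)
    (x : Fin n → ℝ) (hx : x ∈ K) (S : Matrix (Fin n) (Fin n) ℝ)
    (hS : S ∈ doublyStochastic ℝ (Fin n)) : S *ᵥ x ∈ K ∧ g x ≤ g (S *ᵥ x) := by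
  have hc := hg.convex_ge (g x)
  let L : Matrix (Fin n) (Fin n) ℝ →ₗ[ℝ] (Fin n → ℝ) :=
    { toFun := fun S => S *ᵥ x
      map_add' := fun A B => add_mulVec A B x
      map_smul' := fun c A => smul_mulVec c A x }
  have hp := hc.linear_preimage L
  have hS' : S ∈ (doublyStochastic ℝ (Fin n) : Set (Matrix (Fin n) (Fin n) ℝ)) := hS
  rw [doublyStochastic_eq_convexHull_permMatrix] at hS'
  have := convexHull_min (s := {x | ∃ σ : Equiv.Perm (Fin n), σ.permMatrix ℝ = x}) ?_ hp hS'
  · exact this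
  · rintro _ ⟨σ, rfl⟩
    have e : L (σ.permMatrix ℝ) = x ∘ σ := permMatrix_mulVec ..
    simp only [Set.mem_preimage, Set.mem_ofPred_eq, e]
    exact ⟨hK x hx σ, (hgs x hx σ).ge⟩

lemma sumArctanEig_eq {n : ℕ} (M : Matrix (Fin n) (Fin n) ℝ) (h : M.IsHermitian) :
    sumArctanEig M = ∑ i, arctan (h.eigenvalues i) := by
  unfold sumArctanEig
  rw [dif_pos h]

open Matrix in
/-- Davis-type lemma: the spectral argument for a convex combination. -/
lemma davis {n : ℕ} (K : Set (Fin n → ℝ)) (g : (Fin n → ℝ) → ℝ) (hg : ConcaveOn ℝ K g)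
    (hK : ∀ x ∈ K, ∀ σ : Equiv.Perm (Fin n), x ∘ σ ∈ K)
    (hgs : ∀ x ∈ K, ∀ σ : Equiv.Perm (Fin n), g (x ∘ σ) = g x)
    (M N : Matrix (Fin n) (Fin n) ℝ) (hM : M.IsHermitian) (hN : N.IsHermitian)
    (hMK : hM.eigenvalues ∈ K) (hNK : hN.eigenvalues ∈ K) (a b : ℝ) (ha : 0 ≤ a) (hb : 0 ≤ b)
    (hab : a + b = 1) (hP : (a • M + b • N).IsHermitian) :
    hP.eigenvalues ∈ K ∧ a • g hM.eigenvalues + b • g hN.eigenvalues ≤ g hP.eigenvalues := by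
  obtain ⟨U, hU1, hU2, hU⟩ := spec _ hP
  obtain ⟨S, hS, eS⟩ := diag_mem U M hM hU1 hU2
  obtain ⟨T, hT, eT⟩ := diag_mem U N hN hU1 hU2
  have s1 := schur K g hg hK hgs _ hMK S hS
  have s2 := schur K g hg hK hgs _ hNK T hT
  have e : hP.eigenvalues = a • (S *ᵥ hM.eigenvalues) + b • (T *ᵥ hN.eigenvalues) := by
    have e1 : Uᵀ * (a • M + b • N) * U = diagonal hP.eigenvalues := by
      conv_lhs => rw [hU]
      rw [Matrix.mul_assoc, Matrix.mul_assoc, Matrix.mul_assoc, hU1, Matrix.mul_one,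
        ← Matrix.mul_assoc, hU1, Matrix.one_mul]
    rw [← eS, ← eT]
    funext i
    have := congrFun (congrFun e1 i) i
    rw [diagonal_apply_eq] at this
    rw [← this]
    simp [Matrix.mul_add, Matrix.add_mul]
  rw [e]
  refine ⟨hg.1 s1.1 s2.1 ha hb hab, le_trans ?_ (hg.2 s1.1 s2.1 ha hb hab)⟩
  simp only [smul_eq_mul]
  have := mul_le_mul_of_nonneg_left s1.2 ha
  have := mul_le_mul_of_nonneg_left s2.2 hb
  linarith

/-- There is `A = A(δ) > 0` such that `G(M) = −exp(−A ∑ᵢ arctan λᵢ(M))` is concave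
on `Γ = {M symmetric : ∑ᵢ arctan λᵢ(M) ≥ (n−2)π/2 + δ}` and elliptic on `Γ`, in the
sense that `G` is strictly monotone with respect to the Loewner ordering of
symmetric matrices. -/
theorem statement7 (n : ℕ) (hn : 2 ≤ n) (δ : ℝ) (hδ0 : 0 < δ) (hδ1 : δ < π / 2) :
    ∃ A : ℝ, 0 < A ∧
      ConcaveOn ℝ {M : Matrix (Fin n) (Fin n) ℝ |
          M.IsHermitian ∧ ((n : ℝ) - 2) * π / 2 + δ ≤ sumArctanEig M}
        (fun M => -Real.exp (-A * sumArctanEig M)) ∧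
      ∀ M : Matrix (Fin n) (Fin n) ℝ, M.IsHermitian →
        ((n : ℝ) - 2) * π / 2 + δ ≤ sumArctanEig M →
        ∀ N : Matrix (Fin n) (Fin n) ℝ, N.IsHermitian →
          (N - M).PosSemidef → N ≠ M →
          -Real.exp (-A * sumArctanEig M) < -Real.exp (-A * sumArctanEig N) := by
  obtain ⟨A, hA, hg⟩ := vec_concave n hn δ hδ0 hδ1
  have hperm : ∀ (x : Fin n → ℝ) (σ : Equiv.Perm (Fin n)),
      ∑ i, arctan ((x ∘ σ) i) = ∑ i, arctan (x i) := fun x σ =>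
    Equiv.sum_comp σ (fun i => arctan (x i))
  have D := davis _ _ hg (fun x hx σ => by
    simpa only [Set.mem_ofPred_eq, hperm] using hx) (fun x _ σ => by simp only [hperm])
  have hH : ∀ (M N : Matrix (Fin n) (Fin n) ℝ), M.IsHermitian → N.IsHermitian → ∀ a b : ℝ,
      (a • M + b • N).IsHermitian := by
    intro M N hM hN a b
    unfold Matrix.IsHermitian at hM hN ⊢
    rw [Matrix.conjTranspose_add, Matrix.conjTranspose_smul, Matrix.conjTranspose_smul, hM, hN]
    simp
  refine ⟨A, hA, ⟨?_, ?_⟩, ?_⟩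
  · rintro M ⟨hM, hM'⟩ N ⟨hN, hN'⟩ a b ha hb hab
    have hP := hH M N hM hN a b
    rw [sumArctanEig_eq M hM] at hM'
    rw [sumArctanEig_eq N hN] at hN'
    refine ⟨hP, ?_⟩
    rw [sumArctanEig_eq _ hP]
    exact (D M N hM hN hM' hN' a b ha hb hab hP).1
  · rintro M ⟨hM, hM'⟩ N ⟨hN, hN'⟩ a b ha hb hab
    have hP := hH M N hM hN a b
    rw [sumArctanEig_eq M hM] at hM'
    rw [sumArctanEig_eq N hN] at hN'
    have := (D M N hM hN hM' hN' a b ha hb hab hP).2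
    simp only [sumArctanEig_eq _ hP, sumArctanEig_eq _ hM, sumArctanEig_eq _ hN]
    exact this
  · intro M hM _ N hN hNM hne
    rw [sumArctanEig_eq M hM, sumArctanEig_eq N hN, neg_lt_neg_iff, exp_lt_exp]
    have := strict M N hM hN hNM hne
    nlinarith
end
end

section
/- Let n ≥ 2, 0 < δ < π/2, δ′ > 0 and A > 0. There exists a constant Λ > 0, depending only on n, δ, δ′ and A, such that for every κ ∈ ℝⁿ with (n−2)π/2 + δ ≤ ∑_{i=1}^n arctan κᵢ ≤ nπ/2 − δ′, one has A e^{−A ∑ᵢ arctan κᵢ} ∑_{i=1}^n 1/(1+κᵢ²) ≥ Λ. -/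
open Real

/-- Uniform positive lower bound `Λ` for `A e^{−A∑arctan κᵢ} ∑ᵢ 1/(1+κᵢ²)`, valid
whenever `(n−2)π/2 + δ ≤ ∑ᵢ arctan κᵢ ≤ nπ/2 − δ′`. -/
theorem statement10 (n : ℕ) (hn : 2 ≤ n) (δ δ' A : ℝ)
    (hδ0 : 0 < δ) (hδ1 : δ < π / 2) (hδ' : 0 < δ') (hA : 0 < A) :
    ∃ Λ : ℝ, 0 < Λ ∧ ∀ κ : Fin n → ℝ,
      ((n : ℝ) - 2) * π / 2 + δ ≤ ∑ i, Real.arctan (κ i) →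
      (∑ i, Real.arctan (κ i)) ≤ (n : ℝ) * π / 2 - δ' →
      Λ ≤ A * Real.exp (-A * ∑ i, Real.arctan (κ i)) * ∑ i, 1 / (1 + κ i ^ 2) := by
  have hn0 : (0 : ℝ) < n := by
    have : 0 < n := by omega
    exact_mod_cast this
  obtain ⟨m, hm⟩ : ∃ m, m = min δ (δ' / n) := ⟨_, rfl⟩
  have hm0 : 0 < m := by rw [hm]; exact lt_min hδ0 (div_pos hδ' hn0)
  have hm1 : m ≤ δ := by rw [hm]; exact min_le_left _ _
  have hm2 : m ≤ δ' / n := by rw [hm]; exact min_le_right _ _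
  have hsin : 0 < Real.sin m := Real.sin_pos_of_pos_of_lt_pi hm0 (by linarith)
  refine ⟨A * Real.exp (-A * (n * π / 2)) * Real.sin m ^ 2, by positivity, ?_⟩
  intro κ h1 h2
  obtain ⟨i, hi⟩ : ∃ i, Real.arctan (κ i) ≤ π / 2 - δ' / n := by
    by_contra! hc
    have hlt : ∑ _i : Fin n, (π / 2 - δ' / n) < ∑ i, Real.arctan (κ i) :=
      Finset.sum_lt_sum_of_nonempty ⟨⟨0, by omega⟩, Finset.mem_univ _⟩ (fun i _ => hc i)
    rw [Finset.sum_const, Finset.card_univ, Fintype.card_fin, nsmul_eq_mul] at hlt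
    have : (n : ℝ) * (π / 2 - δ' / n) = n * π / 2 - δ' := by field_simp
    linarith
  have hlow : -(π / 2) + δ ≤ Real.arctan (κ i) := by
    have h3 : ∑ j ∈ Finset.univ.erase i, Real.arctan (κ j) ≤
        ∑ _j ∈ Finset.univ.erase i, (π / 2) :=
      Finset.sum_le_sum (fun j _ => (Real.arctan_lt_pi_div_two _).le)
    rw [Finset.sum_const, Finset.card_erase_of_mem (Finset.mem_univ _), Finset.card_univ,
      Fintype.card_fin, nsmul_eq_mul, Nat.cast_sub (by omega)] at h3
    have h4 := Finset.add_sum_erase Finset.univ (fun j => Real.arctan (κ j)) (Finset.mem_univ i)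
    push_cast at h3
    linarith
  have habs : |Real.arctan (κ i)| ≤ π / 2 - m := by
    rw [abs_le]; constructor <;> linarith
  have hcos : Real.sin m ≤ Real.cos (Real.arctan (κ i)) := by
    rw [← Real.cos_pi_div_two_sub, ← Real.cos_abs (Real.arctan (κ i))]
    exact Real.cos_le_cos_of_nonneg_of_le_pi (abs_nonneg _) (by linarith [Real.pi_pos]) habs
  have hsq : Real.sin m ^ 2 ≤ 1 / (1 + κ i ^ 2) := by
    rw [← Real.cos_sq_arctan]
    exact pow_le_pow_left₀ hsin.le hcos 2
  have hsum : Real.sin m ^ 2 ≤ ∑ j, 1 / (1 + κ j ^ 2) :=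
    hsq.trans (Finset.single_le_sum (f := fun j => 1 / (1 + κ j ^ 2))
      (fun j _ => by positivity) (Finset.mem_univ i))
  have hexp : Real.exp (-A * (n * π / 2)) ≤ Real.exp (-A * ∑ j, Real.arctan (κ j)) := by
    apply Real.exp_le_exp.mpr
    nlinarith
  gcongr
end

section
/- Let n ≥ 2, 0 < δ < π/2 and A > 0. There exist constants s₁, s₂, s₃ > 0, depending only on n, δ and A, such that for every κ ∈ ℝⁿ with ∑_{i=1}^n arctan κᵢ ≥ (n−2)π/2 + δ: (a) 0 ≤ A e^{−A ∑ᵢ arctan κᵢ} ∑_{i=1}^n 1/(1+κᵢ²) ≤ s₁, and (b) s₂ ≤ A e^{−A ∑ᵢ arctan κᵢ} ∑_{i=1}^n κᵢ²/(1+κᵢ²) ≤ s₃. -/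
open Real

/-- Two-sided bounds: on `{∑ᵢ arctan κᵢ ≥ (n−2)π/2 + δ}` one has
`0 ≤ A e^{−AF(κ)} ∑ᵢ 1/(1+κᵢ²) ≤ s₁` and
`s₂ ≤ A e^{−AF(κ)} ∑ᵢ κᵢ²/(1+κᵢ²) ≤ s₃`. -/
theorem statement11 (n : ℕ) (hn : 2 ≤ n) (δ A : ℝ)
    (hδ0 : 0 < δ) (hδ1 : δ < π / 2) (hA : 0 < A) :
    ∃ s₁ s₂ s₃ : ℝ, 0 < s₁ ∧ 0 < s₂ ∧ 0 < s₃ ∧ ∀ κ : Fin n → ℝ,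
      ((n : ℝ) - 2) * π / 2 + δ ≤ ∑ i, Real.arctan (κ i) →
      (0 ≤ A * Real.exp (-A * ∑ i, Real.arctan (κ i)) * ∑ i, 1 / (1 + κ i ^ 2) ∧
        A * Real.exp (-A * ∑ i, Real.arctan (κ i)) * ∑ i, 1 / (1 + κ i ^ 2) ≤ s₁) ∧
      (s₂ ≤ A * Real.exp (-A * ∑ i, Real.arctan (κ i)) *
          ∑ i, κ i ^ 2 / (1 + κ i ^ 2) ∧
        A * Real.exp (-A * ∑ i, Real.arctan (κ i)) *
          ∑ i, κ i ^ 2 / (1 + κ i ^ 2) ≤ s₃) := by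
  have hn0 : (2 : ℝ) ≤ n := by exact_mod_cast hn
  have hnpos : (0 : ℝ) < n := by linarith
  have hπ := Real.pi_pos
  have hd1 : 0 < δ / n := by positivity
  have hd2 : δ / n < π / 2 := by
    rw [div_lt_iff₀ hnpos]
    nlinarith
  set t := Real.tan (δ / n) with ht
  have htpos : 0 < t := Real.tan_pos_of_pos_of_lt_pi_div_two hd1 hd2
  have hat : Real.arctan t = δ / n := Real.arctan_tan (by linarith) hd2
  refine ⟨A * 1 * n, A * Real.exp (-A * (n * (π / 2))) * (t ^ 2 / (1 + t ^ 2)), A * 1 * n,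
    by positivity, by positivity, by positivity, ?_⟩
  intro κ hκ
  have hS : δ ≤ ∑ i, Real.arctan (κ i) := by nlinarith
  have hSu : ∑ i, Real.arctan (κ i) ≤ n * (π / 2) := by
    calc ∑ i, Real.arctan (κ i) ≤ ∑ _i : Fin n, π / 2 :=
          Finset.sum_le_sum fun i _ => (Real.arctan_lt_pi_div_two _).le
      _ = n * (π / 2) := by simp
  have hexp : Real.exp (-A * ∑ i, Real.arctan (κ i)) ≤ 1 := by
    rw [Real.exp_le_one_iff]
    nlinarith
  have hexp2 : Real.exp (-A * (n * (π / 2))) ≤ Real.exp (-A * ∑ i, Real.arctan (κ i)) := by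
    rw [Real.exp_le_exp]
    nlinarith
  have hs1 : ∑ i, 1 / (1 + κ i ^ 2) ≤ (n : ℝ) := by
    calc ∑ i, 1 / (1 + κ i ^ 2) ≤ ∑ _i : Fin n, (1 : ℝ) :=
          Finset.sum_le_sum fun i _ => by
            rw [div_le_one (by positivity)]
            nlinarith [sq_nonneg (κ i)]
      _ = n := by simp
  have hs3 : ∑ i, κ i ^ 2 / (1 + κ i ^ 2) ≤ (n : ℝ) := by
    calc ∑ i, κ i ^ 2 / (1 + κ i ^ 2) ≤ ∑ _i : Fin n, (1 : ℝ) :=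
          Finset.sum_le_sum fun i _ => by
            rw [div_le_one (by positivity)]
            linarith
      _ = n := by simp
  have h1 : 0 ≤ ∑ i, 1 / (1 + κ i ^ 2) := Finset.sum_nonneg fun i _ => by positivity
  have h3 : 0 ≤ ∑ i, κ i ^ 2 / (1 + κ i ^ 2) := Finset.sum_nonneg fun i _ => by positivity
  have hs2 : t ^ 2 / (1 + t ^ 2) ≤ ∑ i, κ i ^ 2 / (1 + κ i ^ 2) := by
    obtain ⟨j, hj⟩ : ∃ j, δ / n ≤ Real.arctan (κ j) := by
      by_contra! h
      have : ∑ i, Real.arctan (κ i) < ∑ _i : Fin n, δ / n :=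
        Finset.sum_lt_sum_of_nonempty ⟨⟨0, by omega⟩, Finset.mem_univ _⟩ fun i _ => h i
      have h' : ∑ _i : Fin n, δ / n = δ := by
        simp
        field_simp
      linarith
    have hj' : t ≤ κ j := by
      rw [← hat] at hj
      exact Real.arctan_strictMono.le_iff_le.mp hj
    calc t ^ 2 / (1 + t ^ 2) ≤ κ j ^ 2 / (1 + κ j ^ 2) := by
          rw [div_le_div_iff₀ (by positivity) (by positivity)]
          nlinarith
      _ ≤ _ := Finset.single_le_sum (f := fun i => κ i ^ 2 / (1 + κ i ^ 2))
          (fun i _ => by positivity) (Finset.mem_univ j)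
  refine ⟨⟨by positivity, by gcongr⟩, by gcongr, by gcongr⟩
end

section
/- Let n ≥ 2, let d₁, …, d_{n−1} be fixed real numbers and let C > 0. For a, a₁, …, a_{n−1} ∈ ℝ let M be the n×n symmetric matrix with diagonal entries d₁, …, d_{n−1}, a, with last-column (and last-row) off-diagonal entries M_{αn} = M_{nα} = a_α for 1 ≤ α ≤ n−1, and with all other off-diagonal entries zero. Then there exists a constant K > 0 depending only on d₁,…,d_{n−1} and C, and for every ε > 0 there exists R > 0 depending only on ε, d₁,…,d_{n−1} and C, such that whenever a ≥ R and |a_α| ≤ C for all α, the eigenvalues of M can be labeled λ₁, …, λₙ so that |λ_α − d_α| ≤ ε for 1 ≤ α ≤ n−1 and |λₙ − a| ≤ K. -/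
open Real

lemma aux_perm {ι : Type*} [Fintype ι] [DecidableEq ι] (M : Matrix ι ι ℝ) (hM : M.IsHermitian)
    (E : Matrix ι ι ℝ) (c ε : ι → ℝ) (hε : ∀ i, 0 < ε i)
    (h1 : ∀ x : ι → ℝ, (1 / 3) * ∑ i, x i ^ 2 ≤ ∑ i, (E.mulVec x i) ^ 2)
    (h2 : ∑ i, ∑ α, ((M * E - E * Matrix.diagonal c) i α / ε α) ^ 2 ≤ 1 / 4) :
    ∃ σ : Equiv.Perm ι, ∀ α, |hM.eigenvalues (σ α) - c α| ≤ ε α := by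
  classical
  obtain ⟨V, hVV, hVM⟩ : ∃ V : Matrix ι ι ℝ, V.transpose * V = 1 ∧
      V * M = Matrix.diagonal hM.eigenvalues * V := by
    refine ⟨(star (hM.eigenvectorUnitary : Matrix ι ι ℝ)), ?_, ?_⟩
    · have h : (hM.eigenvectorUnitary : Matrix ι ι ℝ) *
          star (hM.eigenvectorUnitary : Matrix ι ι ℝ) = 1 :=
        Unitary.coe_mul_star_self hM.eigenvectorUnitary
      rw [Matrix.star_eq_conjTranspose, Matrix.conjTranspose_eq_transpose_of_trivial] at h ⊢
      simpa using h
    · have h := hM.spectral_theorem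
      have hU := Unitary.coe_star_mul_self hM.eigenvectorUnitary
      rw [Unitary.conjStarAlgAut_apply] at h
      refine (congrArg (fun X => star (hM.eigenvectorUnitary : Matrix ι ι ℝ) * X) h).trans ?_
      rw [← mul_assoc, ← mul_assoc, hU, one_mul]
      rfl
  have hnorm : ∀ y : ι → ℝ, ∑ i, (V.mulVec y i) ^ 2 = ∑ i, y i ^ 2 := by
    intro y
    have : (V.mulVec y) ⬝ᵥ (V.mulVec y) = y ⬝ᵥ y := by
      rw [Matrix.dotProduct_mulVec, ← Matrix.mulVec_transpose, Matrix.mulVec_mulVec, hVV,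
        Matrix.one_mulVec]
    simpa [dotProduct, sq] using this
  set P := V * E with hP
  set Rm := M * E - E * Matrix.diagonal c with hR
  have hVR : ∀ j α, (V * Rm) j α = (hM.eigenvalues j - c α) * P j α := by
    intro j α
    have : V * Rm = Matrix.diagonal hM.eigenvalues * P - P * Matrix.diagonal c := by
      rw [hR, hP, mul_sub, ← mul_assoc, hVM, mul_assoc, mul_assoc]
    rw [this]
    simp [Matrix.diagonal_mul, Matrix.mul_diagonal]
    ring
  let Q : Matrix ι ι ℝ := fun j α => if |hM.eigenvalues j - c α| ≤ ε α then P j α else 0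
  have hdiff : ∀ j α, (P j α - Q j α) ^ 2 ≤ ((V * Rm) j α / ε α) ^ 2 := by
    intro j α
    by_cases h : |hM.eigenvalues j - c α| ≤ ε α
    · simp only [Q, if_pos h, sub_self, ne_eq, OfNat.ofNat_ne_zero, not_false_eq_true, zero_pow]
      exact sq_nonneg _
    · simp only [Q, if_neg h, sub_zero]
      rw [hVR, sq_le_sq, abs_div, abs_mul, abs_of_pos (hε α), le_div_iff₀ (hε α), mul_comm]
      push Not at h
      exact mul_le_mul_of_nonneg_right h.le (abs_nonneg _)
  have hsum : ∑ j, ∑ α, (P j α - Q j α) ^ 2 ≤ 1 / 4 := by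
    refine le_trans (Finset.sum_le_sum fun j _ => Finset.sum_le_sum fun α _ => hdiff j α) ?_
    refine le_trans (le_of_eq ?_) h2
    rw [Finset.sum_comm, Finset.sum_comm (f := fun i α => (Rm i α / ε α) ^ 2)]
    refine Finset.sum_congr rfl fun α _ => ?_
    simp only [div_pow, ← Finset.sum_div]
    congr 1
    exact hnorm (fun i => Rm i α)
  have hdet : Q.det ≠ 0 := by
    intro h0
    obtain ⟨x, hx, hQx⟩ := Matrix.exists_mulVec_eq_zero_iff.mpr h0
    apply hx
    have e1 : ∑ j, (P.mulVec x j) ^ 2 ≤ 1 / 4 * ∑ i, x i ^ 2 := by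
      calc ∑ j, (P.mulVec x j) ^ 2 = ∑ j, (∑ α, (P j α - Q j α) * x α) ^ 2 := by
            refine Finset.sum_congr rfl fun j _ => ?_
            have h3 : ∑ α, Q j α * x α = 0 := congrFun hQx j
            simp only [sub_mul, Finset.sum_sub_distrib, h3, sub_zero]
            rfl
        _ ≤ ∑ j, (∑ α, (P j α - Q j α) ^ 2) * ∑ α, x α ^ 2 :=
            Finset.sum_le_sum fun j _ => Finset.sum_mul_sq_le_sq_mul_sq _ _ _
        _ = (∑ j, ∑ α, (P j α - Q j α) ^ 2) * ∑ α, x α ^ 2 := by rw [Finset.sum_mul]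
        _ ≤ _ := mul_le_mul_of_nonneg_right hsum (Finset.sum_nonneg fun _ _ => sq_nonneg _)
    have e2 : ∑ j, (P.mulVec x j) ^ 2 = ∑ j, (E.mulVec x j) ^ 2 := by
      rw [hP, ← Matrix.mulVec_mulVec, hnorm]
    have e3 := h1 x
    have e4 : ∑ i, x i ^ 2 = 0 :=
      le_antisymm (by linarith) (Finset.sum_nonneg fun _ _ => sq_nonneg _)
    rw [Finset.sum_eq_zero_iff_of_nonneg fun _ _ => sq_nonneg _] at e4
    ext i
    simpa using e4 i (Finset.mem_univ i)
  rw [Matrix.det_apply] at hdet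
  obtain ⟨σ, -, hσ⟩ := Finset.exists_ne_zero_of_sum_ne_zero hdet
  refine ⟨σ, fun α => ?_⟩
  by_contra hcon
  apply hσ
  rw [Finset.prod_eq_zero (Finset.mem_univ α), smul_zero]
  simp only [Q, if_neg hcon]



/-- Perturbation of the eigenvalues of an arrowhead-type symmetric matrix:
with fixed diagonal entries `d₁,…,d_{n−1}`, last diagonal entry `a → ∞`, and last
row/column `|a_α| ≤ C`, the eigenvalues can be labeled `λ₁,…,λₙ` with
`λ_α = d_α + o(1)` and `λₙ = a(1 + O(1/a))`. -/
theorem statement19 (n : ℕ) (hn : 2 ≤ n) (d : Fin n → ℝ) (C : ℝ) (hC : 0 < C) :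
    ∃ K : ℝ, 0 < K ∧ ∀ ε : ℝ, 0 < ε → ∃ R : ℝ, 0 < R ∧
      ∀ (a : ℝ) (av : Fin n → ℝ), R ≤ a →
        (∀ α : Fin n, (α : ℕ) < n - 1 → |av α| ≤ C) →
        ∀ hM : (Matrix.of fun i j : Fin n =>
            if i = j then (if (i : ℕ) = n - 1 then a else d i)
            else if (j : ℕ) = n - 1 then av i
            else if (i : ℕ) = n - 1 then av j
            else (0 : ℝ)).IsHermitian,
          ∃ σ : Equiv.Perm (Fin n),
            (∀ α : Fin n, (α : ℕ) < n - 1 →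
              |hM.eigenvalues (σ α) - d α| ≤ ε) ∧
            |hM.eigenvalues (σ ⟨n - 1, by omega⟩) - a| ≤ K := by

  have hn0 : (0 : ℝ) < n := by exact_mod_cast (by omega : 0 < n)
  have hn1 : (1 : ℝ) ≤ n := by exact_mod_cast (by omega : 1 ≤ n)
  obtain ⟨N, hN⟩ : ∃ N : Fin n, N = ⟨n - 1, by omega⟩ := ⟨_, rfl⟩
  have hNv : ∀ i : Fin n, (i : ℕ) = n - 1 ↔ i = N := by
    intro i; rw [hN, Fin.ext_iff]
  have hlt : ∀ i : Fin n, (i : ℕ) < n - 1 ↔ i ≠ N := by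
    intro i; rw [← not_iff_not, not_not, ← hNv]; omega
  obtain ⟨D, hD0, hD⟩ : ∃ D : ℝ, 0 ≤ D ∧ ∀ i, |d i| ≤ D :=
    ⟨∑ i, |d i|, Finset.sum_nonneg fun _ _ => abs_nonneg _, fun i =>
      Finset.single_le_sum (f := fun i => |d i|) (fun _ _ => abs_nonneg _) (Finset.mem_univ i)⟩
  refine ⟨2 * n * C, by positivity, fun ε hε => ?_⟩
  refine ⟨6 * n * C + 2 * n * (C * C + C * D) / ε, by positivity, ?_⟩
  intro a av ha hav hM
  simp only [hlt, ← hN] at hav ⊢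
  have hq : 0 ≤ 2 * n * (C * C + C * D) / ε := by positivity
  have hp : 0 < 6 * n * C := by positivity
  have ha0 : 0 < a := by linarith
  have ha1 : 6 * n * C ≤ a := by linarith
  have ha2 : (C * C + C * D) / a ≤ ε / (2 * n) := by
    have : 2 * n * (C * C + C * D) / ε ≤ a := by linarith
    rw [div_le_iff₀ hε] at this
    rw [div_le_div_iff₀ ha0 (by positivity)]
    linarith
  let w : Fin n → ℝ := fun α => if α = N then 0 else av α / a
  have hw : ∀ α, |w α| ≤ C / a := by
    intro α
    by_cases h : α = N
    · simp only [w, if_pos h, abs_zero]; positivity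
    · simp only [w, if_neg h, abs_div, abs_of_pos ha0]
      exact div_le_div_of_nonneg_right (hav α h) ha0.le
  have hCa : C / a ≤ 1 / (6 * n) := by
    rw [div_le_div_iff₀ ha0 (by positivity)]; linarith
  let E : Matrix (Fin n) (Fin n) ℝ :=
    fun i α => (if i = α then 1 else 0) - (if i = N then w α else 0)
  let c : Fin n → ℝ := fun i => if i = N then a else d i
  let e : Fin n → ℝ := fun i => if i = N then 2 * n * C else ε
  have he : ∀ i, 0 < e i := by
    intro i; simp only [e]; split_ifs <;> positivity
  suffices hmain : ∃ σ : Equiv.Perm (Fin n), ∀ α, |hM.eigenvalues (σ α) - c α| ≤ e α by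
    obtain ⟨σ, hσ⟩ := hmain
    refine ⟨σ, fun α hα => ?_, ?_⟩
    · simpa [c, e, hα] using hσ α
    · simpa [c, e] using hσ N
  refine aux_perm _ hM E c e he ?_ ?_
  · intro x
    set s := ∑ α, w α * x α with hs
    have hE : ∀ i, E.mulVec x i = x i - if i = N then s else 0 := by
      intro i
      simp only [Matrix.mulVec, dotProduct, E, sub_mul, Finset.sum_sub_distrib, ite_mul, one_mul,
        zero_mul, Finset.sum_ite_eq, Finset.mem_univ, if_true]
      split_ifs <;> simp [hs]
    have hS : ∑ i, (E.mulVec x i) ^ 2 = ∑ i, x i ^ 2 + (s ^ 2 - 2 * x N * s) := by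
      have : ∀ i, (E.mulVec x i) ^ 2 = x i ^ 2 + if i = N then s ^ 2 - 2 * x N * s else 0 := by
        intro i
        rw [hE]
        split_ifs with h
        · subst h; ring
        · ring
      simp only [this, Finset.sum_add_distrib, Finset.sum_ite_eq', Finset.mem_univ, if_true]
    have hX : 0 ≤ ∑ i, x i ^ 2 := Finset.sum_nonneg fun _ _ => sq_nonneg _
    have hxN : x N ^ 2 ≤ ∑ i, x i ^ 2 :=
      Finset.single_le_sum (f := fun i => x i ^ 2) (fun _ _ => sq_nonneg _) (Finset.mem_univ N)
    have hw2 : ∑ α, w α ^ 2 ≤ 1 / 6 := by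
      have h : ∀ α ∈ Finset.univ, w α ^ 2 ≤ 1 / (6 * n) := by
        intro α _
        have h1 : |w α| ≤ 1 / (6 * n) := (hw α).trans hCa
        have h2 : 1 / (6 * (n : ℝ)) ≤ 1 := by
          rw [div_le_one (by positivity)]; linarith
        rw [← sq_abs]
        nlinarith [abs_nonneg (w α)]
      refine (Finset.sum_le_sum h).trans (le_of_eq ?_)
      simp
      field_simp
    have hs2 : s ^ 2 ≤ 1 / 6 * ∑ i, x i ^ 2 :=
      (Finset.sum_mul_sq_le_sq_mul_sq _ _ _).trans (mul_le_mul_of_nonneg_right hw2 hX)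
    rw [hS]
    nlinarith [sq_nonneg (x N - 2 * s)]
  · generalize hMM : (Matrix.of fun i j : Fin n =>
            if i = j then (if (i : ℕ) = n - 1 then a else d i)
            else if (j : ℕ) = n - 1 then av i
            else if (i : ℕ) = n - 1 then av j
            else (0 : ℝ)) = M
    have hMe : ∀ i j, M i j = if i = j then (if i = N then a else d i)
            else if j = N then av i else if i = N then av j else 0 := by
      intro i j; rw [← hMM]; simp only [Matrix.of_apply, hNv]
    have hRe : ∀ i α, (M * E - E * Matrix.diagonal c) i α
        = M i α - M i N * w α - E i α * c α := by
      intro i α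
      rw [Matrix.sub_apply, Matrix.mul_diagonal, Matrix.mul_apply]
      simp [E, mul_sub, Finset.sum_sub_distrib]
    have hb : ∀ i α, |(M * E - E * Matrix.diagonal c) i α / e α| ≤ 1 / (2 * n) := by
      intro i α
      rw [abs_div, abs_of_pos (he α), div_le_iff₀ (he α), hRe]
      by_cases hα : α = N
      · subst hα
        by_cases hi : i = α
        · subst hi
          simp [hMe, w, E, c, e]
          positivity
        · simp [hMe, w, E, c, e, hi]
          refine (hav i hi).trans (le_of_eq ?_)
          field_simp
      · have hε' : 1 / (2 * n) * e α = ε / (2 * n) := by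
          simp only [e, if_neg hα]; ring
        rw [hε']
        refine le_trans ?_ ha2
        have hwα : av α = a * w α := by
          simp only [w, if_neg hα]; field_simp
        have key : ∀ t u : ℝ, |t| ≤ C → |u| ≤ D → 0 ≤ C * C + C * D →
            |t * w α| ≤ (C * C + C * D) / a ∧ |u * w α| ≤ (C * C + C * D) / a := by
          intro t u ht hu _
          rw [abs_mul, abs_mul]
          have hCa0 : 0 ≤ C / a := by positivity
          have hh : (C * C + C * D) / a = C * (C / a) + D * (C / a) := by ring
          have k1 := mul_le_mul ht (hw α) (abs_nonneg _) hC.le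
          have k2 := mul_le_mul hu (hw α) (abs_nonneg _) hD0
          have k3 : 0 ≤ C * (C / a) := by positivity
          have k4 : 0 ≤ D * (C / a) := by positivity
          rw [hh]
          constructor <;> linarith
        by_cases hi : i = N
        · subst hi
          have : M i α - M i i * w α - E i α * c α = d α * w α := by
            simp [hMe, E, c, hα, Ne.symm hα, hwα, mul_comm]
          rw [this]
          exact (key 0 (d α) (by simpa using hC.le) (hD α) (by positivity)).2
        · have : M i α - M i N * w α - E i α * c α = - (av i * w α) := by
            by_cases hiα : i = α
            · subst hiα
              simp [hMe, E, c, hi]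
            · simp [hMe, E, c, hi, hα, hiα]
          rw [this, abs_neg]
          exact (key (av i) 0 (hav i hi) (by simpa using hD0) (by positivity)).1
    calc _ ≤ ∑ i : Fin n, ∑ α : Fin n, (1 / (2 * (n : ℝ))) ^ 2 := by
          refine Finset.sum_le_sum fun i _ => Finset.sum_le_sum fun α _ => ?_
          rw [← sq_abs]
          exact pow_le_pow_left₀ (abs_nonneg _) (hb i α) 2
      _ = 1 / 4 := by
          simp
          field_simp
          try norm_num
      _ ≤ 1 / 4 := le_rfl
end
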